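/- Let Γ be a finite group acting linearly on ℝⁿ, fix x₀ ∈ ℝⁿ with isotropy subgroup Σ_{x₀} = {γ ∈ Γ : γ·x₀ = x₀}, and let V be a Σ_{x₀}-invariant open neighborhood of x₀ in ℝⁿ such that γ·cl(V) ∩ cl(V) = ∅ for every γ ∈ Γ \ Σ_{x₀}, where cl(V) denotes the closure of V. Let g : cl(V) × ℝ → ℝⁿ be a smooth map satisfying g(σ·x, λ) = σ·g(x, λ) for all σ ∈ Σ_{x₀}, x ∈ cl(V), λ ∈ ℝ. Then there exists a smooth map f : ℝⁿ × ℝ → ℝⁿ with f(γ·x, λ) = γ·f(x, λ) for all γ ∈ Γ, x ∈ ℝⁿ, λ ∈ ℝ, whose restriction to cl(V) × ℝ equals g. -/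

import Mathlib

/-- Extension of a smooth `Σ_{x₀}`-equivariant vector field defined near the closure of an
invariant neighborhood `V` of `x₀` (whose closure is moved off itself by every group element
outside the isotropy subgroup) to a globally smooth `Γ`-equivariant vector field. -/
theorem extend_isotropy_equivariant_field
    (n : ℕ) (Γ : Type*) [Group Γ] [Fintype Γ]
    (ρ : Representation ℝ Γ (Fin n → ℝ))
    (x₀ : Fin n → ℝ) (V : Set (Fin n → ℝ))
    (hVopen : IsOpen V) (hx₀V : x₀ ∈ V)
    (hVinv : ∀ σ : Γ, ρ σ x₀ = x₀ → ρ σ '' V = V)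
    (hdisj : ∀ γ : Γ, ρ γ x₀ ≠ x₀ → (ρ γ '' closure V) ∩ closure V = ∅)
    (g : (Fin n → ℝ) × ℝ → (Fin n → ℝ)) (hg : ContDiff ℝ (⊤ : ℕ∞) g)
    (hgequiv : ∀ σ : Γ, ρ σ x₀ = x₀ →
      ∀ x ∈ closure V, ∀ lam : ℝ, g (ρ σ x, lam) = ρ σ (g (x, lam))) :
    ∃ f : (Fin n → ℝ) × ℝ → (Fin n → ℝ),
      ContDiff ℝ (⊤ : ℕ∞) f ∧
      (∀ (γ : Γ) (x : Fin n → ℝ) (lam : ℝ), f (ρ γ x, lam) = ρ γ (f (x, lam))) ∧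
      ∀ x ∈ closure V, ∀ lam : ℝ, f (x, lam) = g (x, lam) := by
  classical
  have hcont (γ : Γ) : Continuous (ρ γ) := (ρ γ).continuous_of_finiteDimensional
  have hinv (γ : Γ) (x : Fin n → ℝ) : ρ γ⁻¹ (ρ γ x) = x := by
    rw [← Module.End.mul_apply, ← map_mul]; simp
  have hinv' (γ : Γ) (x : Fin n → ℝ) : ρ γ (ρ γ⁻¹ x) = x := by
    rw [← Module.End.mul_apply, ← map_mul]; simp
  have hcl (σ : Γ) (hσ : ρ σ x₀ = x₀) (x : Fin n → ℝ) (hx : x ∈ closure V) :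
      ρ σ x ∈ closure V := by
    have h := image_closure_subset_closure_image (hcont σ) (Set.mem_image_of_mem (ρ σ) hx)
    rwa [hVinv σ hσ] at h
  obtain ⟨φ, hφ, hφ0, hφ1⟩ : ∃ φ : (Fin n → ℝ) → ℝ, ContDiff ℝ (⊤ : ℕ∞) φ ∧
      (∀ x ∈ closure V, ∀ γ : Γ, ρ γ x₀ ≠ x₀ → φ (ρ γ x) = 0) ∧ ∀ x ∈ closure V, φ x = 1 := by
    have hclosed : IsClosed (⋃ γ : {γ : Γ // ρ γ x₀ ≠ x₀}, ρ γ.1⁻¹ ⁻¹' closure V) :=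
      isClosed_iUnion_of_finite fun γ => isClosed_closure.preimage (hcont _)
    have hd : Disjoint (⋃ γ : {γ : Γ // ρ γ x₀ ≠ x₀}, ρ γ.1⁻¹ ⁻¹' closure V) (closure V) := by
      rw [Set.disjoint_left]
      intro x hx hxV
      obtain ⟨⟨γ, hγ⟩, hx⟩ := Set.mem_iUnion.1 hx
      exact (hdisj γ hγ).subset ⟨⟨_, hx, hinv' γ x⟩, hxV⟩
    obtain ⟨φ, h0, h1, -⟩ := exists_contMDiffMap_zero_one_of_isClosed
      (n := (⊤ : ℕ∞)) (modelWithCornersSelf ℝ (Fin n → ℝ))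
      hclosed isClosed_closure hd
    refine ⟨φ, φ.contMDiff.contDiff, fun x hx γ hγ => h0 ?_, fun x hx => h1 hx⟩
    refine Set.mem_iUnion.2 ⟨⟨γ, hγ⟩, ?_⟩
    simpa [hinv] using hx
  have hsmooth (γ : Γ) : ContDiff ℝ (⊤ : ℕ∞) (ρ γ) :=
    (LinearMap.toContinuousLinearMap (ρ γ)).contDiff
  let c : ℝ := (Finset.univ.filter fun γ : Γ => ρ γ x₀ = x₀).card
  have hc : c ≠ 0 :=
    Nat.cast_ne_zero.2 (Finset.card_ne_zero.2 ⟨1, by simp⟩)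
  refine ⟨fun p => c⁻¹ • ∑ γ : Γ, φ (ρ γ p.1) • ρ γ⁻¹ (g (ρ γ p.1, p.2)), ?_, ?_, ?_⟩
  · refine contDiff_const.fun_smul (ContDiff.sum fun γ _ => ?_)
    have h1 : ContDiff ℝ (⊤ : ℕ∞) fun p : (Fin n → ℝ) × ℝ => ρ γ p.1 :=
      (hsmooth γ).comp contDiff_fst
    exact (hφ.comp h1).fun_smul ((hsmooth γ⁻¹).comp (hg.comp (h1.prodMk contDiff_snd)))
  · intro δ x lam
    simp only [map_smul, map_sum]
    congr 1
    refine Fintype.sum_equiv (Equiv.mulRight δ) _ _ fun γ => ?_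
    simp only [Equiv.coe_mulRight, mul_inv_rev, map_mul, Module.End.mul_apply, hinv']
  · intro x hx lam
    have hterm (γ : Γ) : φ (ρ γ x) • ρ γ⁻¹ (g (ρ γ x, lam)) =
        if ρ γ x₀ = x₀ then g (x, lam) else 0 := by
      split_ifs with hγ
      · rw [hφ1 _ (hcl γ hγ x hx), hgequiv γ hγ x hx, hinv, one_smul]
      · rw [hφ0 x hx γ hγ, zero_smul]
    simp only [hterm, ← Finset.sum_filter, Finset.sum_const]
    rw [← Nat.cast_smul_eq_nsmul ℝ, inv_smul_smul₀ hc]
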